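/- Fix integers k ≥ 2 and p ≥ 1, let (w_{1,n}, …, w_{p,n}) be independent F_k-valued random variables satisfying radial symmetry, positive drift with drift constant L > 0, and subexponential growth, and fix β with 0 < β < L/2. Then with probability going to 1 exponentially fast as n → ∞: each w_{i,n} has length at least βn, and all subwords of length ⌊βn⌋ of the 2p reduced words w_{1,n}^{±1}, …, w_{p,n}^{±1} are distinct; that is, the map sending a triple (i, ε, j), where 1 ≤ i ≤ p, ε ∈ {±1}, and j is a starting position, to the subword of length ⌊βn⌋ of the reduced word of w_{i,n}^{ε} starting at position j, is injective. -/

import Mathlib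

open MeasureTheory

noncomputable section

/-- Every set of a free group is measurable (discrete σ-algebra). -/
instance freeGroupMeasurableSpace {α : Type*} : MeasurableSpace (FreeGroup α) := ⊤

/-- The length `|g|` of the reduced word representing `g`. -/
def wlen {k : ℕ} (g : FreeGroup (Fin k)) : ℕ := (FreeGroup.toWord g).length

/-- The reduced word of `g` (if `ε = true`) or of `g⁻¹` (if `ε = false`). -/
def signedWord {k : ℕ} (g : FreeGroup (Fin k)) (ε : Bool) : List (Fin k × Bool) :=
  FreeGroup.toWord (if ε then g else g⁻¹)

/-- A family of "failure probabilities" decays exponentially: the corresponding events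
hold with probability going to 1 exponentially fast as `n → ∞`. -/
def ExpDecay (f : ℕ → ENNReal) : Prop :=
  ∃ C : ℝ, 0 < C ∧ ∃ κ : ℝ, 1 < κ ∧ ∀ n : ℕ, f n ≤ ENNReal.ofReal (C / κ ^ n)

/-- The inverse of a letter of a free group. -/
def letterInv {α : Type*} (a : α × Bool) : α × Bool := (a.1, !a.2)

lemma letterInv_letterInv {α : Type*} (a : α × Bool) : letterInv (letterInv a) = a := by
  simp [letterInv]

lemma letterInv_ne_self {α : Type*} (a : α × Bool) : letterInv a ≠ a := by
  intro h
  have := congrArg Prod.snd h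
  simp [letterInv] at this

lemma cancels_iff_eq_letterInv {α : Type*} {a b : α × Bool} :
    ¬ (a.1 = b.1 → a.2 = b.2) ↔ b = letterInv a := by
  obtain ⟨a, ea⟩ := a
  obtain ⟨b, eb⟩ := b
  cases ea <;> cases eb <;> simp [letterInv, eq_comm]

lemma FreeGroup.IsReduced.getElem_succ_ne {α : Type*} {u : List (α × Bool)}
    (hu : FreeGroup.IsReduced u) {i : ℕ} (hi : i + 1 < u.length) :
    u[i + 1] ≠ letterInv u[i] := by
  rw [Ne, ← cancels_iff_eq_letterInv, not_not]
  exact List.isChain_iff_getElem.1 hu i hi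

/-- A reduced word contains no subword pair exchanged by inversion with overlapping positions. -/
lemma FreeGroup.IsReduced.not_overlap_inverse {α : Type*} {u : List (α × Bool)}
    (hu : FreeGroup.IsReduced u) {j s m : ℕ} (hj : j + m ≤ u.length) (hs : s + m ≤ u.length)
    (hjs : j < s + m) (hsj : s < j + m)
    (h : ∀ t < m, u[j + t]? = (u[s + (m - 1 - t)]?).map letterInv) : False := by
  obtain ⟨a, ha⟩ : ∃ a, a = (j + s + m - 1) / 2 := ⟨_, rfl⟩
  have key := h (a - j) (by omega)
  have e1 : j + (a - j) = a := by omega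
  rw [e1, List.getElem?_eq_getElem (by omega), List.getElem?_eq_getElem (by omega)] at key
  simp only [Option.map_some, Option.some.injEq] at key
  rcases Nat.even_or_odd' (j + s + m - 1) with ⟨c, hc | hc⟩
  · have e2 : s + (m - 1 - (a - j)) = a := by omega
    simp only [e2] at key
    exact letterInv_ne_self _ key.symm
  · have e2 : s + (m - 1 - (a - j)) = a + 1 := by omega
    simp only [e2] at key
    have hne := hu.getElem_succ_ne (i := a) (by omega)
    rw [key, letterInv_letterInv] at hne
    exact hne rfl

/-- The finite set of reduced words of length `l` in `k` generators. -/
def reducedWords (k l : ℕ) : Finset (List (Fin k × Bool)) :=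
  ((List.finite_length_eq (Fin k × Bool) l).inter_of_left
    {u | FreeGroup.IsReduced u}).toFinset

lemma mem_reducedWords {k l : ℕ} {u : List (Fin k × Bool)} :
    u ∈ reducedWords k l ↔ u.length = l ∧ FreeGroup.IsReduced u := by
  simp [reducedWords]

lemma card_erase_letter {k : ℕ} (a : Fin k × Bool) :
    (Finset.univ.erase a).card = 2 * k - 1 := by
  rw [Finset.card_erase_of_mem (Finset.mem_univ _), Finset.card_univ]
  simp [mul_comm]

lemma pow_le_card_reducedWords (k l : ℕ) : (2 * k - 1) ^ l ≤ (reducedWords k l).card := by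
  induction l with
  | zero =>
    have : [] ∈ reducedWords k 0 := by simp [mem_reducedWords]
    simpa using Finset.card_pos.2 ⟨_, this⟩
  | succ l ih =>
    rw [pow_succ']
    refine (Nat.mul_le_mul_left _ ih).trans
      (Finset.mul_card_image_le_card_of_maps_to (f := List.tail) ?_ _ ?_)
    · intro u hu
      rw [mem_reducedWords] at hu ⊢
      exact ⟨by simp [hu.1], hu.2.infix (List.tail_suffix u).isInfix⟩
    · intro b hb
      rw [mem_reducedWords] at hb
      have hsub : ∃ a : Fin k × Bool → Prop, 2 * k - 1 ≤ (Set.ncard {x | a x}) ∧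
          ∀ x, a x → FreeGroup.IsReduced (x :: b) := by
        cases b with
        | nil => exact ⟨fun _ => True, by simp [Set.ncard_univ]; omega, by simp⟩
        | cons c b =>
          refine ⟨fun x => x ≠ letterInv c, ?_, ?_⟩
          · have := card_erase_letter (letterInv c)
            rw [← this, ← Set.ncard_coe_finset]
            refine le_of_eq (congrArg _ ?_)
            ext x; simp
          · intro x hx
            rw [FreeGroup.isReduced_cons_cons]
            refine ⟨?_, hb.2⟩
            by_contra hcon
            rw [cancels_iff_eq_letterInv] at hcon
            exact hx (by rw [hcon, letterInv_letterInv])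
      obtain ⟨a, hcard, ha⟩ := hsub
      refine hcard.trans ?_
      rw [← Set.ncard_coe_finset]
      refine Set.ncard_le_ncard_of_injOn (fun x => x :: b) ?_ ?_ (Finset.finite_toSet _)
      · intro x hx
        simp [mem_reducedWords, hb.1, ha x hx]
      · intro x _ y _ hxy
        exact (List.cons.inj hxy).1

/-- If all words in `A` are reduced of length `l` and, at each of the `m` positions following `s`,
the letter of a word of `A` is a function of its preceding letters, then `A` has at most
`2 (2k-1)^(l-m)` elements. -/
lemma card_le_of_determined {k l s m : ℕ} (hk : 1 ≤ k) (A : Finset (List (Fin k × Bool)))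
    (hA : ∀ u ∈ A, u.length = l ∧ FreeGroup.IsReduced u) (hsm : s + m ≤ l)
    (hdet : ∀ u ∈ A, ∀ v ∈ A, ∀ t < m, u.take (s + t) = v.take (s + t) →
      u[s + t]? = v[s + t]?) :
    A.card ≤ 2 * (2 * k - 1) ^ (l - m) := by
  classical
  have hq : 1 ≤ 2 * k - 1 := by omega
  have hfree : ∀ r, 1 ≤ r → r < l →
      (A.image (List.take (r + 1))).card ≤ (2 * k - 1) * (A.image (List.take r)).card := by
    intro r hr hrl
    refine Finset.card_le_mul_card_image_of_maps_to (f := List.take r) ?_ _ ?_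
    · intro w hw
      obtain ⟨u, hu, rfl⟩ := Finset.mem_image.1 hw
      rw [List.take_take, min_eq_left (by omega)]
      exact Finset.mem_image_of_mem _ hu
    · intro b hb
      obtain ⟨v, hv, rfl⟩ := Finset.mem_image.1 hb
      have hvl := (hA v hv).1
      rw [← card_erase_letter (letterInv (v[r - 1]))]
      refine le_trans (Finset.card_le_card (t := (Finset.univ.erase
        (letterInv (v[r - 1]))).image (fun x => v.take r ++ [x])) ?_) Finset.card_image_le
      intro w hw
      obtain ⟨hw, hwb⟩ := Finset.mem_filter.1 hw
      obtain ⟨u, hu, rfl⟩ := Finset.mem_image.1 hw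
      rw [List.take_take, min_eq_left (by omega)] at hwb
      have hul := (hA u hu).1
      refine Finset.mem_image.2 ⟨u[r], ?_, ?_⟩
      · refine Finset.mem_erase.2 ⟨?_, Finset.mem_univ _⟩
        have h1 := (hA u hu).2.getElem_succ_ne (i := r - 1) (by omega)
        have h2 : u[r - 1]? = v[r - 1]? := by
          rw [← List.getElem?_take_of_lt (show r - 1 < r by omega), hwb,
            List.getElem?_take_of_lt (by omega)]
        rw [List.getElem?_eq_getElem (by omega), List.getElem?_eq_getElem (by omega),
          Option.some.injEq] at h2
        rw [h2] at h1
        simpa only [Nat.sub_add_cancel hr] using h1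
      · simp [← hwb]
  have hfix : ∀ t < m,
      (A.image (List.take (s + t + 1))).card ≤ (A.image (List.take (s + t))).card := by
    intro t ht
    refine Finset.card_le_card_of_injOn (List.take (s + t)) ?_ ?_
    · intro w hw
      obtain ⟨u, hu, rfl⟩ := Finset.mem_image.1 (Finset.mem_coe.1 hw)
      rw [Finset.mem_coe, List.take_take, min_eq_left (by omega)]
      exact Finset.mem_image_of_mem _ hu
    · intro w hw w' hw' hww
      obtain ⟨u, hu, rfl⟩ := Finset.mem_image.1 (Finset.mem_coe.1 hw)
      obtain ⟨v, hv, rfl⟩ := Finset.mem_image.1 (Finset.mem_coe.1 hw')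
      simp only [List.take_take, min_eq_left (Nat.le_succ _)] at hww
      rw [List.take_add_one, List.take_add_one, hww, hdet u hu v hv t ht hww]
  have hone : 1 ≤ l → (A.image (List.take 1)).card ≤ 2 * k := by
    intro hl
    refine (Finset.card_le_card (t := Finset.univ.image fun x => [x]) ?_).trans
      (Finset.card_image_le.trans (by simp [mul_comm]))
    intro w hw
    obtain ⟨u, hu, rfl⟩ := Finset.mem_image.1 hw
    have hul := (hA u hu).1
    refine Finset.mem_image.2 ⟨u[0], Finset.mem_univ _, ?_⟩
    cases u with
    | nil => simp at hul; omega
    | cons a u => simp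
  have main : ∀ r ≤ l, (A.image (List.take r)).card ≤ 2 * (2 * k - 1) ^ (r - min m (r - s)) := by
    intro r
    induction r with
    | zero =>
      intro _
      refine (Finset.card_le_one.2 ?_).trans (by simp)
      intro a ha b hb
      simp only [List.take_zero, Finset.mem_image] at ha hb
      obtain ⟨_, _, rfl⟩ := ha
      obtain ⟨_, _, rfl⟩ := hb
      rfl
    | succ r ih =>
      intro hr
      have ih := ih (by omega)
      by_cases hd : s ≤ r ∧ r < s + m
      · obtain ⟨t, rfl⟩ := Nat.exists_eq_add_of_le hd.1
        have e : s + t + 1 - min m (s + t + 1 - s) = s + t - min m (s + t - s) := by omega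
        rw [e]
        exact (hfix t (by omega)).trans ih
      · have e : r + 1 - min m (r + 1 - s) = r - min m (r - s) + 1 := by omega
        rw [e, pow_succ]
        rcases Nat.eq_zero_or_pos r with rfl | hr0
        · refine (hone (by omega)).trans ?_
          simp
          omega
        · refine (hfree r hr0 (by omega)).trans ?_
          calc _ ≤ (2 * k - 1) * (2 * (2 * k - 1) ^ (r - min m (r - s))) := Nat.mul_le_mul_left _ ih
            _ = _ := by ring
  have hAl : A.image (List.take l) = A := by
    rw [Finset.image_congr (g := id), Finset.image_id]
    intro u hu
    exact List.take_of_length_le (hA u hu).1.le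
  have := main l le_rfl
  rwa [hAl, min_eq_left (by omega)] at this

instance freeGroupDiscreteMeasurableSpace {α : Type*} :
    DiscreteMeasurableSpace (FreeGroup α) := ⟨fun _ => trivial⟩

lemma length_signedWord {k : ℕ} (g : FreeGroup (Fin k)) (ε : Bool) :
    (signedWord g ε).length = wlen g := by
  cases ε <;> simp [signedWord, wlen, FreeGroup.toWord_inv]

lemma isReduced_signedWord {k : ℕ} (g : FreeGroup (Fin k)) (ε : Bool) :
    FreeGroup.IsReduced (signedWord g ε) := FreeGroup.isReduced_toWord

lemma signedWord_injective {k : ℕ} (ε : Bool) :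
    Function.Injective (fun g : FreeGroup (Fin k) => signedWord g ε) := by
  intro g h hgh
  cases ε
  · simpa [signedWord, -FreeGroup.toWord_inv] using hgh
  · simpa [signedWord] using hgh

lemma signedWord_not {k : ℕ} (g : FreeGroup (Fin k)) (ε : Bool) :
    signedWord g (!ε) = FreeGroup.invRev (signedWord g ε) := by
  cases ε <;> simp [signedWord, FreeGroup.toWord_inv]

lemma getElem?_invRev {α : Type*} (u : List (α × Bool)) {i : ℕ} (hi : i < u.length) :
    (FreeGroup.invRev u)[i]? = (u[u.length - 1 - i]?).map letterInv := by
  rw [FreeGroup.invRev, List.getElem?_reverse (by simpa using hi), List.getElem?_map]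
  simp only [List.length_map]
  rfl

lemma getElem?_eq_of_take_drop_eq {α : Type*} {u v : List α} {j j' m : ℕ}
    (h : (u.drop j).take m = (v.drop j').take m) {t : ℕ} (ht : t < m) :
    u[j + t]? = v[j' + t]? := by
  have := congrArg (fun w => w[t]?) h
  simpa [List.getElem?_take_of_lt ht, List.getElem?_drop] using this

lemma getElem?_eq_of_take_eq {α : Type*} {u v : List α} {r i : ℕ}
    (h : u.take r = v.take r) (hi : i < r) : u[i]? = v[i]? := by
  rw [← List.getElem?_take_of_lt hi, h, List.getElem?_take_of_lt hi]

/-- The finite set of elements of word length `l` of the free group of rank `k`. -/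
def wordSphere (k l : ℕ) : Finset (FreeGroup (Fin k)) :=
  (reducedWords k l).image FreeGroup.mk

lemma mem_wordSphere {k l : ℕ} {g : FreeGroup (Fin k)} : g ∈ wordSphere k l ↔ wlen g = l := by
  simp only [wordSphere, Finset.mem_image, mem_reducedWords]
  constructor
  · rintro ⟨u, ⟨hl, hu⟩, rfl⟩
    rw [wlen, FreeGroup.toWord_mk, hu.reduce_eq, hl]
  · exact fun h => ⟨g.toWord, ⟨h, FreeGroup.isReduced_toWord⟩, FreeGroup.mk_toWord⟩

lemma card_wordSphere (k l : ℕ) : (wordSphere k l).card = (reducedWords k l).card := by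
  refine Finset.card_image_of_injOn ?_
  intro u hu v hv huv
  rw [Finset.mem_coe, mem_reducedWords] at hu hv
  have := congrArg FreeGroup.toWord huv
  rwa [FreeGroup.toWord_mk, FreeGroup.toWord_mk, hu.2.reduce_eq, hv.2.reduce_eq] at this

/-- `Determined E l ε s m` says that, for the elements `g` of `E` of length `l`, each of the `m`
letters of `g^ε` following position `s` is a function of the preceding letters. -/
def Determined {k : ℕ} (E : Set (FreeGroup (Fin k))) (l : ℕ) (ε : Bool) (s m : ℕ) : Prop :=
  ∀ g ∈ E, wlen g = l → ∀ h ∈ E, wlen h = l → ∀ t < m,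
    (signedWord g ε).take (s + t) = (signedWord h ε).take (s + t) →
      (signedWord g ε)[s + t]? = (signedWord h ε)[s + t]?

section Radial

variable {k : ℕ} {μ : Measure (FreeGroup (Fin k))}

lemma measure_inter_sphere_le_of_determined (hk : 2 ≤ k)
    (hμ : ∀ g g' : FreeGroup (Fin k), wlen g = wlen g' → μ {g} = μ {g'})
    {E : Set (FreeGroup (Fin k))} {l s m : ℕ} {ε : Bool} (hsm : s + m ≤ l)
    (hE : Determined E l ε s m) :
    μ (E ∩ {g | wlen g = l}) * ((2 * k - 1 : ℕ) : ENNReal) ^ m ≤ 2 * μ {g | wlen g = l} := by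
  classical
  have hS : {g : FreeGroup (Fin k) | wlen g = l} = wordSphere k l := by
    ext g; simp [mem_wordSphere]
  have hF : E ∩ {g : FreeGroup (Fin k) | wlen g = l} =
      ((wordSphere k l).filter (· ∈ E) : Finset _) := by
    ext g; simp [mem_wordSphere, and_comm]
  set F := (wordSphere k l).filter (· ∈ E) with hFdef
  rcases (wordSphere k l).eq_empty_or_nonempty with h0 | ⟨g₀, hg₀⟩
  · have : F = ∅ := by simp [hFdef, h0]
    rw [hF, this]
    simp
  have hc : ∀ g ∈ wordSphere k l, μ {g} = μ {g₀} := fun g hg =>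
    hμ _ _ (by rw [mem_wordSphere.1 hg, mem_wordSphere.1 hg₀])
  have hmF : ∀ g ∈ F, g ∈ E ∧ wlen g = l := fun g hg =>
    ⟨(Finset.mem_filter.1 hg).2, mem_wordSphere.1 (Finset.mem_filter.1 hg).1⟩
  rw [hF, hS, ← sum_measure_singleton, ← sum_measure_singleton, Finset.sum_congr rfl hc,
    Finset.sum_congr rfl (fun g hg => hc g (Finset.mem_filter.1 hg).1)]
  simp only [Finset.sum_const, nsmul_eq_mul]
  have hcard : F.card ≤ 2 * (2 * k - 1) ^ (l - m) := by
    rw [← Finset.card_image_of_injective F (signedWord_injective ε)]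
    refine card_le_of_determined (s := s) (l := l) (by omega) _ ?_ hsm ?_
    · intro u hu
      obtain ⟨g, hg, rfl⟩ := Finset.mem_image.1 hu
      exact ⟨by rw [length_signedWord, (hmF g hg).2], isReduced_signedWord g ε⟩
    · intro u hu v hv
      obtain ⟨g, hg, rfl⟩ := Finset.mem_image.1 hu
      obtain ⟨h, hh, rfl⟩ := Finset.mem_image.1 hv
      exact hE g (hmF g hg).1 (hmF g hg).2 h (hmF h hh).1 (hmF h hh).2
  have hnat : F.card * (2 * k - 1) ^ m ≤ 2 * (wordSphere k l).card := by
    calc F.card * (2 * k - 1) ^ m ≤ 2 * (2 * k - 1) ^ (l - m) * (2 * k - 1) ^ m :=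
          Nat.mul_le_mul_right _ hcard
      _ = 2 * (2 * k - 1) ^ l := by
          rw [mul_assoc, ← pow_add, Nat.sub_add_cancel (by omega)]
      _ ≤ 2 * (wordSphere k l).card := by
          rw [card_wordSphere]
          exact Nat.mul_le_mul_left _ (pow_le_card_reducedWords k l)
  have hnat' : (F.card : ENNReal) * ((2 * k - 1 : ℕ) : ENNReal) ^ m
      ≤ 2 * ((wordSphere k l).card : ENNReal) := by exact_mod_cast hnat
  calc _ = (F.card : ENNReal) * ((2 * k - 1 : ℕ) : ENNReal) ^ m * μ {g₀} := by ring
    _ ≤ 2 * ((wordSphere k l).card : ENNReal) * μ {g₀} := by gcongr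
    _ = _ := by ring

lemma measure_eq_tsum_inter_sphere (E : Set (FreeGroup (Fin k))) :
    μ E = ∑' l, μ (E ∩ {g | wlen g = l}) := by
  rw [← measure_iUnion]
  · congr 1
    ext g; simp
  · intro a b hab
    refine Set.disjoint_left.2 ?_
    rintro g ⟨_, ha⟩ ⟨_, hb⟩
    exact hab (ha.symm.trans hb)
  · exact fun _ => MeasurableSet.of_discrete

lemma measure_le_of_determined (hk : 2 ≤ k) [IsProbabilityMeasure μ]
    (hμ : ∀ g g' : FreeGroup (Fin k), wlen g = wlen g' → μ {g} = μ {g'})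
    {E : Set (FreeGroup (Fin k))} {m : ℕ}
    (hE : ∀ g ∈ E, ∃ ε s, s + m ≤ wlen g ∧ Determined E (wlen g) ε s m) :
    μ E ≤ 2 / ((2 * k - 1 : ℕ) : ENNReal) ^ m := by
  have hq : ((2 * k - 1 : ℕ) : ENNReal) ≠ 0 := by
    rw [Nat.cast_ne_zero]; omega
  rw [ENNReal.le_div_iff_mul_le (Or.inl (pow_ne_zero _ hq))
    (Or.inl (ENNReal.pow_ne_top (ENNReal.natCast_ne_top _))),
    measure_eq_tsum_inter_sphere E, ← ENNReal.tsum_mul_right]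
  have huniv : ∑' l, μ {g | wlen g = l} = 1 := by
    have := measure_eq_tsum_inter_sphere (μ := μ) Set.univ
    simpa using this.symm
  calc _ ≤ ∑' l, 2 * μ {g | wlen g = l} := by
        refine ENNReal.tsum_le_tsum fun l => ?_
        rcases (E ∩ {g | wlen g = l}).eq_empty_or_nonempty with h0 | ⟨g, hg, rfl⟩
        · simp [h0]
        · obtain ⟨ε, s, hsm, hdet⟩ := hE g hg
          exact measure_inter_sphere_le_of_determined hk hμ hsm hdet
    _ = 2 := by rw [ENNReal.tsum_mul_left, huniv, mul_one]

lemma measure_subword_eq_le (hk : 2 ≤ k) [IsProbabilityMeasure μ]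
    (hμ : ∀ g g' : FreeGroup (Fin k), wlen g = wlen g' → μ {g} = μ {g'})
    (m j : ℕ) (ε : Bool) (v : List (Fin k × Bool)) :
    μ {g | j + m ≤ (signedWord g ε).length ∧ ((signedWord g ε).drop j).take m = v}
      ≤ 2 / ((2 * k - 1 : ℕ) : ENNReal) ^ m := by
  refine measure_le_of_determined hk hμ ?_
  rintro g ⟨hl, -⟩
  rw [length_signedWord] at hl
  refine ⟨ε, j, hl, ?_⟩
  rintro g ⟨-, hg⟩ - h ⟨-, hh⟩ - t ht -
  exact getElem?_eq_of_take_drop_eq (hg.trans hh.symm) ht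

lemma measure_repeated_subword_le (hk : 2 ≤ k) [IsProbabilityMeasure μ]
    (hμ : ∀ g g' : FreeGroup (Fin k), wlen g = wlen g' → μ {g} = μ {g'})
    (m : ℕ) {j j' : ℕ} (hj : j < j') (ε : Bool) :
    μ {g | j' + m ≤ (signedWord g ε).length ∧
        ((signedWord g ε).drop j).take m = ((signedWord g ε).drop j').take m}
      ≤ 2 / ((2 * k - 1 : ℕ) : ENNReal) ^ m := by
  refine measure_le_of_determined hk hμ ?_
  rintro g ⟨hl, -⟩
  rw [length_signedWord] at hl
  refine ⟨ε, j', hl, ?_⟩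
  rintro g ⟨-, hg⟩ - h ⟨-, hh⟩ - t ht htake
  rw [← getElem?_eq_of_take_drop_eq hg ht, ← getElem?_eq_of_take_drop_eq hh ht]
  exact getElem?_eq_of_take_eq htake (by omega)

lemma measure_inverse_subword_le (hk : 2 ≤ k) [IsProbabilityMeasure μ]
    (hμ : ∀ g g' : FreeGroup (Fin k), wlen g = wlen g' → μ {g} = μ {g'})
    (m j j' : ℕ) (ε : Bool) :
    μ {g | j + m ≤ (signedWord g ε).length ∧ j' + m ≤ (signedWord g (!ε)).length ∧
        ((signedWord g ε).drop j).take m = ((signedWord g (!ε)).drop j').take m}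
      ≤ 2 / ((2 * k - 1 : ℕ) : ENNReal) ^ m := by
  refine measure_le_of_determined hk hμ ?_
  have key : ∀ g : FreeGroup (Fin k), j' + m ≤ wlen g →
      ((signedWord g ε).drop j).take m = ((signedWord g (!ε)).drop j').take m →
      ∀ t < m, (signedWord g ε)[j + t]? =
        ((signedWord g ε)[wlen g - j' - m + (m - 1 - t)]?).map letterInv := by
    intro g hl heq t ht
    rw [getElem?_eq_of_take_drop_eq heq ht, signedWord_not,
      getElem?_invRev _ (by rw [length_signedWord]; omega), length_signedWord]
    congr 2
    omega
  rintro g ⟨hl, hl', heq⟩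
  rw [length_signedWord] at hl hl'
  rcases le_or_gt (j + m) (wlen g - j' - m) with h1 | h1
  · refine ⟨ε, wlen g - j' - m, by omega, ?_⟩
    rintro a ⟨-, -, ha⟩ hla b ⟨-, -, hb⟩ hlb t ht htake
    have ka := key a (by omega) ha (m - 1 - t) (by omega)
    have kb := key b (by omega) hb (m - 1 - t) (by omega)
    rw [show m - 1 - (m - 1 - t) = t by omega] at ka kb
    rw [hla] at ka
    rw [hlb] at kb
    have := getElem?_eq_of_take_eq htake (i := j + (m - 1 - t)) (by omega)
    rw [ka, kb] at this
    exact Option.map_injective (Function.Involutive.injective letterInv_letterInv) this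
  rcases le_or_gt (wlen g - j' - m + m) j with h2 | h2
  · refine ⟨ε, j, hl, ?_⟩
    rintro a ⟨-, -, ha⟩ hla b ⟨-, -, hb⟩ hlb t ht htake
    rw [key a (by omega) ha t ht, key b (by omega) hb t ht, hla, hlb,
      getElem?_eq_of_take_eq htake (by omega)]
  · exact ((isReduced_signedWord g ε).not_overlap_inverse (j := j) (s := wlen g - j' - m)
      (m := m) (by rw [length_signedWord]; omega) (by rw [length_signedWord]; omega)
      (by omega) (by omega) (key g hl' heq)).elim

end Radial

/-- A bound on the conditional probability given one coordinate of a product measure. -/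
lemma pi_le_of_forall_fiber_le {ι α : Type*} [Fintype ι] [MeasurableSpace α] [Countable α]
    [DiscreteMeasurableSpace α] (μ : ι → Measure α) [∀ i, IsProbabilityMeasure (μ i)]
    {i i' : ι} (hi : i ≠ i') (T : α → Set α) {c : ENNReal} (hT : ∀ h, μ i (T h) ≤ c) :
    Measure.pi μ {w | w i ∈ T (w i')} ≤ c := by
  have hind : ProbabilityTheory.IndepFun (fun w : ι → α => w i) (fun w => w i') (Measure.pi μ) :=
    (ProbabilityTheory.iIndepFun_pi (X := fun _ => id) (fun i => aemeasurable_id)).indepFun hi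
  have hev : ∀ (x : ι) (s : Set α), Measure.pi μ ((fun w => w x) ⁻¹' s) = μ x s := fun x s =>
    (measurePreserving_eval μ x).measure_preimage MeasurableSet.of_discrete.nullMeasurableSet
  have hU : {w : ι → α | w i ∈ T (w i')} =
      ⋃ h, (fun w => w i) ⁻¹' (T h) ∩ (fun w => w i') ⁻¹' {h} := by
    ext w; simp
  rw [hU]
  calc _ ≤ ∑' h, Measure.pi μ ((fun w => w i) ⁻¹' (T h) ∩ (fun w => w i') ⁻¹' {h}) :=
        measure_iUnion_le _
    _ ≤ ∑' h, c * μ i' {h} := by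
        refine ENNReal.tsum_le_tsum fun h => ?_
        rw [hind.measure_inter_preimage_eq_mul _ _ MeasurableSet.of_discrete
          MeasurableSet.of_discrete, hev, hev]
        gcongr
        exact hT h
    _ = c := by
        rw [ENNReal.tsum_mul_left]
        have : ∑' h, μ i' {h} = 1 := by
          have h1 := measure_iUnion (μ := μ i') (f := fun h : α => ({h} : Set α))
            (fun a b hab => by simpa using hab) (fun _ => MeasurableSet.of_discrete)
          rw [← h1, Set.iUnion_singleton_eq_range]
          simp
        rw [this, mul_one]

lemma pi_coincidence_le {k p : ℕ} (hk : 2 ≤ k) (μ : Fin p → Measure (FreeGroup (Fin k)))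
    [∀ i, IsProbabilityMeasure (μ i)]
    (hμ : ∀ i (g g' : FreeGroup (Fin k)), wlen g = wlen g' → μ i {g} = μ i {g'})
    (m : ℕ) {i i' : Fin p} {ε ε' : Bool} {j j' : ℕ} (hne : (i, ε, j) ≠ (i', ε', j')) :
    Measure.pi μ {w | j + m ≤ (signedWord (w i) ε).length ∧
        j' + m ≤ (signedWord (w i') ε').length ∧
        ((signedWord (w i) ε).drop j).take m = ((signedWord (w i') ε').drop j').take m}
      ≤ 2 / ((2 * k - 1 : ℕ) : ENNReal) ^ m := by
  have hev : ∀ (x : Fin p) (s : Set (FreeGroup (Fin k))),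
      Measure.pi μ ((fun w => w x) ⁻¹' s) = μ x s := fun x s =>
    (measurePreserving_eval μ x).measure_preimage MeasurableSet.of_discrete.nullMeasurableSet
  by_cases hi : i = i'
  · subst hi
    by_cases hε : ε = ε'
    · subst hε
      have hj : j ≠ j' := fun h => hne (by rw [h])
      rcases hj.lt_or_gt with hj | hj
      · refine le_trans (measure_mono ?_)
          ((hev i _).trans_le (measure_repeated_subword_le hk (hμ i) m hj ε))
        exact fun w hw => ⟨hw.2.1, hw.2.2⟩
      · refine le_trans (measure_mono ?_)
          ((hev i _).trans_le (measure_repeated_subword_le hk (hμ i) m hj ε))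
        exact fun w hw => ⟨hw.1, hw.2.2.symm⟩
    · obtain rfl : ε' = !ε := by cases ε <;> cases ε' <;> simp_all
      exact (hev i _).trans_le (measure_inverse_subword_le hk (hμ i) m j j' ε)
  · have : Countable (FreeGroup (Fin k)) := FreeGroup.toWord_injective.countable
    refine le_trans (measure_mono ?_) (pi_le_of_forall_fiber_le μ hi (fun h =>
      {g | j + m ≤ (signedWord g ε).length ∧
        ((signedWord g ε).drop j).take m = ((signedWord h ε').drop j').take m})
      (fun h => measure_subword_eq_le hk (hμ i) m j ε _))
    exact fun w hw => ⟨hw.1, hw.2.2⟩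

lemma ExpDecay.mono {f g : ℕ → ENNReal} (hg : ExpDecay g) (h : ∀ n, f n ≤ g n) :
    ExpDecay f := by
  obtain ⟨C, hC, κ, hκ, hb⟩ := hg
  exact ⟨C, hC, κ, hκ, fun n => (h n).trans (hb n)⟩

lemma ExpDecay.add {f g : ℕ → ENNReal} (hf : ExpDecay f) (hg : ExpDecay g) :
    ExpDecay (fun n => f n + g n) := by
  obtain ⟨C, hC, κ, hκ, hb⟩ := hf
  obtain ⟨C', hC', κ', hκ', hb'⟩ := hg
  have h0 : 0 < min κ κ' := by positivity
  refine ⟨C + C', by positivity, min κ κ', lt_min hκ hκ', fun n => ?_⟩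
  rw [add_div, ENNReal.ofReal_add (by positivity) (by positivity)]
  refine add_le_add ((hb n).trans (ENNReal.ofReal_le_ofReal ?_))
    ((hb' n).trans (ENNReal.ofReal_le_ofReal ?_))
  · gcongr
    exact min_le_left _ _
  · gcongr
    exact min_le_right _ _

lemma ExpDecay.sum {ι : Type*} (s : Finset ι) {f : ι → ℕ → ENNReal}
    (hf : ∀ i, ExpDecay (f i)) : ExpDecay (fun n => ∑ i ∈ s, f i n) := by
  classical
  induction s using Finset.induction_on with
  | empty => exact ⟨1, one_pos, 2, one_lt_two, fun n => by simp⟩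
  | insert a s ha ih =>
    simp only [Finset.sum_insert ha]
    exact (hf a).add ih

/-- The number of pairs of subwords is at most quadratic in the lengths of the words, so a growth
rate below `β / 2` is beaten by the probability of a coincidence of length `⌊β n⌋`. -/
lemma expDecay_coincidence_bound (k p : ℕ) (hk : 2 ≤ k) {β : ℝ} (hβ : 0 < β) :
    ExpDecay (fun n => (((2 * p * (⌊Real.exp (β / 4 * n)⌋₊ + 1)) ^ 2 : ℕ) : ENNReal) *
      (2 / ((2 * k - 1 : ℕ) : ENNReal) ^ ⌊β * n⌋₊)) := by
  refine ⟨((4 * p) ^ 2 + 1) * (2 * Real.exp 1), by positivity, Real.exp (β / 2),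
    Real.one_lt_exp_iff.2 (by positivity), fun n => ?_⟩
  have hq : (Real.exp 1) ≤ ((2 * k - 1 : ℕ) : ℝ) := by
    have h3 : (3 : ℝ) ≤ ((2 * k - 1 : ℕ) : ℝ) := by
      exact_mod_cast (show 3 ≤ 2 * k - 1 by omega)
    linarith [Real.exp_one_lt_d9]
  have hq0 : (0 : ℝ) < ((2 * k - 1 : ℕ) : ℝ) := (Real.exp_pos 1).trans_le hq
  set N := ⌊Real.exp (β / 4 * n)⌋₊
  have hN : ((N : ℝ) + 1) ≤ 2 * Real.exp (β / 4 * n) := by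
    have h1 : (N : ℝ) ≤ Real.exp (β / 4 * n) := Nat.floor_le (Real.exp_pos _).le
    have h2 : 1 ≤ Real.exp (β / 4 * n) := Real.one_le_exp (by positivity)
    linarith
  have heq : (((2 * p * (N + 1)) ^ 2 : ℕ) : ENNReal) *
      (2 / ((2 * k - 1 : ℕ) : ENNReal) ^ ⌊β * n⌋₊) =
      ENNReal.ofReal ((2 * p * (N + 1)) ^ 2 * (2 / ((2 * k - 1 : ℕ) : ℝ) ^ ⌊β * n⌋₊)) := by
    rw [ENNReal.ofReal_mul (by positivity), ENNReal.ofReal_div_of_pos (by positivity),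
      ENNReal.ofReal_pow hq0.le, ENNReal.ofReal_natCast]
    congr 1
    · rw [← ENNReal.ofReal_natCast]
      push_cast
      rfl
    · simp
  refine heq.trans_le (ENNReal.ofReal_le_ofReal ?_)
  have hpow : 2 / ((2 * k - 1 : ℕ) : ℝ) ^ ⌊β * n⌋₊ ≤ 2 * Real.exp 1 * Real.exp (-(β * n)) := by
    have h1 : Real.exp (β * n - 1) ≤ ((2 * k - 1 : ℕ) : ℝ) ^ ⌊β * n⌋₊ := by
      calc Real.exp (β * n - 1) ≤ Real.exp (⌊β * n⌋₊ * 1) := by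
            refine Real.exp_le_exp.2 ?_
            linarith [Nat.lt_floor_add_one (β * n)]
        _ = Real.exp 1 ^ ⌊β * n⌋₊ := Real.exp_nat_mul _ _
        _ ≤ _ := by gcongr
    calc _ ≤ 2 / Real.exp (β * n - 1) := by gcongr
      _ = _ := by
        rw [div_eq_mul_inv, ← Real.exp_neg, mul_assoc, ← Real.exp_add]
        ring_nf
  calc _ ≤ (2 * p * (2 * Real.exp (β / 4 * n))) ^ 2 *
        (2 * Real.exp 1 * Real.exp (-(β * n))) := by gcongr
    _ = (4 * p) ^ 2 * (2 * Real.exp 1) *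
        (Real.exp (β / 4 * n) * Real.exp (β / 4 * n) * Real.exp (-(β * n))) := by ring
    _ = (4 * p) ^ 2 * (2 * Real.exp 1) / Real.exp (β / 2) ^ n := by
        rw [← Real.exp_add, ← Real.exp_add, ← Real.exp_nat_mul, div_eq_mul_inv _ (Real.exp _),
          ← Real.exp_neg]
        ring_nf
    _ ≤ _ := by
        gcongr
        linarith

/-- `μ n i` is the distribution of `w_{i,n}`; independence is expressed
by the product measure. Under radial symmetry, positive drift with constant `L`, and
subexponential growth, for fixed `0 < β < L/2`, with probability going to 1 exponentially
fast: each `w_{i,n}` has length at least `βn`, and all subwords of length `⌊βn⌋` of the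
`2p` reduced words `w_{i,n}^{±1}` (indexed by `(i, ε, j)` with `j` a valid starting
position) are pairwise distinct. -/
theorem distinct_subwords (k p : ℕ) (hk : 2 ≤ k) (hp : 1 ≤ p)
    (μ : ℕ → Fin p → Measure (FreeGroup (Fin k)))
    (hprob : ∀ n i, IsProbabilityMeasure (μ n i))
    (hradial : ∀ n i (g g' : FreeGroup (Fin k)), wlen g = wlen g' →
      μ n i {g} = μ n i {g'})
    (L : ℝ) (hL : 0 < L)
    (hdrift : ∀ i, ExpDecay (fun n => μ n i {g | ¬ (L * n < (wlen g : ℝ))}))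
    (hsubexp : ∀ θ : ℝ, 0 < θ → ∀ i,
      ExpDecay (fun n => μ n i {g | ¬ ((wlen g : ℝ) ≤ Real.exp (θ * n))}))
    (β : ℝ) (hβ0 : 0 < β) (hβL : β < L / 2) :
    ExpDecay (fun n =>
      Measure.pi (μ n)
        {w : Fin p → FreeGroup (Fin k) |
          ¬ ((∀ i : Fin p, β * n ≤ (wlen (w i) : ℝ)) ∧
            (∀ (i i' : Fin p) (ε ε' : Bool) (j j' : ℕ),
              j + Nat.floor (β * n) ≤ (signedWord (w i) ε).length →
              j' + Nat.floor (β * n) ≤ (signedWord (w i') ε').length →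
              ((signedWord (w i) ε).drop j).take (Nat.floor (β * n)) =
                ((signedWord (w i') ε').drop j').take (Nat.floor (β * n)) →
              (i, ε, j) = (i', ε', j')))}) := by
  have hsub := hsubexp (β / 4) (by positivity)
  refine (((ExpDecay.sum Finset.univ hdrift).add (ExpDecay.sum Finset.univ hsub)).add
    (expDecay_coincidence_bound k p hk hβ0)).mono fun n => ?_
  have := hprob n
  have hev : ∀ (x : Fin p) (s : Set (FreeGroup (Fin k))),
      Measure.pi (μ n) ((fun w => w x) ⁻¹' s) = μ n x s := fun x s =>
    (measurePreserving_eval (μ n) x).measure_preimage MeasurableSet.of_discrete.nullMeasurableSet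
  set m := ⌊β * n⌋₊
  set N := ⌊Real.exp (β / 4 * n)⌋₊
  let T : Finset (Fin p × Bool × ℕ) := Finset.univ ×ˢ Finset.univ ×ˢ Finset.range (N + 1)
  have hT : T.card = 2 * p * (N + 1) := by
    simp only [T, Finset.card_product, Finset.card_univ, Fintype.card_fin, Fintype.card_bool,
      Finset.card_range]
    ring
  let B : (Fin p × Bool × ℕ) × (Fin p × Bool × ℕ) → Set (Fin p → FreeGroup (Fin k)) := fun x =>
    {w | x.1.2.2 + m ≤ (signedWord (w x.1.1) x.1.2.1).length ∧
      x.2.2.2 + m ≤ (signedWord (w x.2.1) x.2.2.1).length ∧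
      ((signedWord (w x.1.1) x.1.2.1).drop x.1.2.2).take m =
        ((signedWord (w x.2.1) x.2.2.1).drop x.2.2.2).take m}
  have hcover : {w : Fin p → FreeGroup (Fin k) |
          ¬ ((∀ i : Fin p, β * n ≤ (wlen (w i) : ℝ)) ∧
            (∀ (i i' : Fin p) (ε ε' : Bool) (j j' : ℕ),
              j + m ≤ (signedWord (w i) ε).length →
              j' + m ≤ (signedWord (w i') ε').length →
              ((signedWord (w i) ε).drop j).take m = ((signedWord (w i') ε').drop j').take m →
              (i, ε, j) = (i', ε', j')))} ⊆
      ((⋃ i ∈ (Finset.univ : Finset (Fin p)),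
          (fun w => w i) ⁻¹' {g | ¬ (L * n < (wlen g : ℝ))}) ∪
        (⋃ i ∈ (Finset.univ : Finset (Fin p)),
          (fun w => w i) ⁻¹' {g | ¬ ((wlen g : ℝ) ≤ Real.exp (β / 4 * n))})) ∪
        ⋃ x ∈ T.offDiag, B x := by
    intro w hw
    by_contra hcon
    simp only [Set.mem_union, Set.mem_iUnion, Set.mem_preimage, Set.mem_ofPred_eq, not_or,
      not_exists, Finset.mem_univ, true_and, not_not, exists_prop] at hcon
    obtain ⟨⟨hlow, hup⟩, hB⟩ := hcon
    refine hw ⟨fun i => ?_, fun i i' ε ε' j j' h1 h2 h3 => ?_⟩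
    · refine le_trans ?_ (hlow i).le
      gcongr
      linarith
    · by_contra hne
      have hmem : ∀ (i : Fin p) (ε : Bool) (j : ℕ), j + m ≤ (signedWord (w i) ε).length →
          (i, ε, j) ∈ T := by
        intro i ε j h
        rw [length_signedWord] at h
        have := Nat.le_floor (hup i)
        simp only [T, Finset.mem_product, Finset.mem_univ, true_and, Finset.mem_range]
        omega
      exact hB ((i, ε, j), (i', ε', j'))
        ⟨Finset.mem_offDiag.2 ⟨hmem i ε j h1, hmem i' ε' j' h2, hne⟩, h1, h2, h3⟩
  refine (measure_mono hcover).trans ((measure_union_le _ _).trans (add_le_add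
    ((measure_union_le _ _).trans (add_le_add ?_ ?_)) ?_))
  · exact (measure_biUnion_finset_le _ _).trans (Finset.sum_le_sum fun i _ => (hev i _).le)
  · exact (measure_biUnion_finset_le _ _).trans (Finset.sum_le_sum fun i _ => (hev i _).le)
  · calc _ ≤ ∑ x ∈ T.offDiag, Measure.pi (μ n) (B x) := measure_biUnion_finset_le _ _
      _ ≤ ∑ x ∈ T.offDiag, 2 / ((2 * k - 1 : ℕ) : ENNReal) ^ m := by
          refine Finset.sum_le_sum fun x hx => ?_
          exact pi_coincidence_le hk (μ n) (hradial n) m (Finset.mem_offDiag.1 hx).2.2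
      _ ≤ _ := by
          rw [Finset.sum_const, nsmul_eq_mul]
          gcongr
          rw [← hT, Finset.offDiag_card, sq]
          exact Nat.sub_le _ _

end
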